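/- arXiv:2105.05174 — 2 statements merged into one kernel-verified Lean document; each statement's English description precedes it below -/
import Mathlib

section
/- Let L be a lattice in ℝ² of covolume 1 with ‖L‖ < 1, and let l ∈ L be a vector with ‖l‖ = ‖L‖. Then for every k ∈ ℤ with e^{|k|}·‖L‖ < 1 one has ‖δ_k L‖ = ‖δ_k l‖, where δ_k = diag(e^k, e^{−k}) and δ_k L = {δ_k v : v ∈ L}. -/
noncomputable section

/-- The minimal norm of the nonzero vectors of a set `L` in a normed group:
`‖L‖ = inf {‖x‖ : x ∈ L ∖ {0}}`. -/
def setMinNorm {E : Type*} [NormedAddCommGroup E] (L : Set E) : ℝ :=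
  sInf {r : ℝ | ∃ x ∈ L, x ≠ 0 ∧ ‖x‖ = r}

/-- The lattice `A·ℤ² ⊆ ℝ²` associated to a matrix `A`. -/
def lat2 (A : Matrix (Fin 2) (Fin 2) ℝ) : Set (EuclideanSpace ℝ (Fin 2)) :=
  {x | ∃ v : Fin 2 → ℤ, x = (WithLp.equiv 2 (Fin 2 → ℝ)).symm (A.mulVec fun i => (v i : ℝ))}

/-- The diagonal flow `δ_t = diag(e^t, e^{−t})` acting on `ℝ²`. -/
def diag2 (t : ℝ) (x : EuclideanSpace ℝ (Fin 2)) : EuclideanSpace ℝ (Fin 2) :=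
  (WithLp.equiv 2 (Fin 2 → ℝ)).symm ![Real.exp t * x 0, Real.exp (-t) * x 1]

/-- The determinant of a pair of vectors of the plane. -/
def planeDet (x y : EuclideanSpace ℝ (Fin 2)) : ℝ := x 0 * y 1 - x 1 * y 0

theorem norm_sq_plane (x : EuclideanSpace ℝ (Fin 2)) : ‖x‖ ^ 2 = x 0 ^ 2 + x 1 ^ 2 := by
  simp [EuclideanSpace.norm_sq_eq, Fin.sum_univ_two]

theorem abs_planeDet_le (x y : EuclideanSpace ℝ (Fin 2)) : |planeDet x y| ≤ ‖x‖ * ‖y‖ := by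
  apply abs_le_of_sq_le_sq _ (by positivity)
  rw [mul_pow, norm_sq_plane, norm_sq_plane, planeDet]
  nlinarith [sq_nonneg (x 0 * y 0 + x 1 * y 1)]

@[simp] theorem diag2_apply_zero (t : ℝ) (x : EuclideanSpace ℝ (Fin 2)) :
    diag2 t x 0 = Real.exp t * x 0 := rfl

@[simp] theorem diag2_apply_one (t : ℝ) (x : EuclideanSpace ℝ (Fin 2)) :
    diag2 t x 1 = Real.exp (-t) * x 1 := rfl

theorem planeDet_diag2 (t : ℝ) (x y : EuclideanSpace ℝ (Fin 2)) :
    planeDet (diag2 t x) (diag2 t y) = planeDet x y := by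
  have h : Real.exp t * Real.exp (-t) = 1 := by rw [← Real.exp_add]; simp
  simp only [planeDet, diag2_apply_zero, diag2_apply_one]
  linear_combination (x 0 * y 1 - x 1 * y 0) * h

theorem diag2_eq_zero_iff {t : ℝ} {x : EuclideanSpace ℝ (Fin 2)} : diag2 t x = 0 ↔ x = 0 := by
  simp [PiLp.ext_iff, Fin.forall_fin_two]

theorem norm_diag2_le (t : ℝ) (x : EuclideanSpace ℝ (Fin 2)) :
    ‖diag2 t x‖ ≤ Real.exp |t| * ‖x‖ := by
  apply le_of_sq_le_sq _ (by positivity)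
  rw [mul_pow, norm_sq_plane, norm_sq_plane, diag2_apply_zero, diag2_apply_one, mul_pow, mul_pow,
    mul_add]
  gcongr
  · exact le_abs_self t
  · exact neg_le_abs t

/-- Among collinear vectors, a diagonal map preserves the order of the norms. -/
theorem norm_diag2_le_norm_diag2 {x y : EuclideanSpace ℝ (Fin 2)} (hxy : planeDet x y = 0)
    (hy : y ≠ 0) (h : ‖x‖ ≤ ‖y‖) (t : ℝ) : ‖diag2 t x‖ ≤ ‖diag2 t y‖ := by
  have hpos : 0 < y 0 ^ 2 + y 1 ^ 2 := by
    rw [← norm_sq_plane]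
    have := norm_pos_iff.mpr hy
    positivity
  have hsq : x 0 ^ 2 + x 1 ^ 2 ≤ y 0 ^ 2 + y 1 ^ 2 := by
    rw [← norm_sq_plane, ← norm_sq_plane]
    gcongr
  have hd : x 0 * y 1 = x 1 * y 0 := sub_eq_zero.mp hxy
  have h0 : x 0 ^ 2 ≤ y 0 ^ 2 := by
    refine le_of_mul_le_mul_right ?_ hpos
    calc x 0 ^ 2 * (y 0 ^ 2 + y 1 ^ 2) = y 0 ^ 2 * (x 0 ^ 2 + x 1 ^ 2) := by
          linear_combination (x 0 * y 1 + x 1 * y 0) * hd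
      _ ≤ _ := by gcongr
  have h1 : x 1 ^ 2 ≤ y 1 ^ 2 := by
    refine le_of_mul_le_mul_right ?_ hpos
    calc x 1 ^ 2 * (y 0 ^ 2 + y 1 ^ 2) = y 1 ^ 2 * (x 0 ^ 2 + x 1 ^ 2) := by
          linear_combination -(x 0 * y 1 + x 1 * y 0) * hd
      _ ≤ _ := by gcongr
  apply le_of_sq_le_sq _ (by positivity)
  rw [norm_sq_plane, norm_sq_plane]
  simp only [diag2_apply_zero, diag2_apply_one, mul_pow]
  gcongr

theorem mem_lat2_iff {A : Matrix (Fin 2) (Fin 2) ℝ} {x : EuclideanSpace ℝ (Fin 2)} :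
    x ∈ lat2 A ↔ ∃ v : Fin 2 → ℤ,
      x 0 = A 0 0 * v 0 + A 0 1 * v 1 ∧ x 1 = A 1 0 * v 0 + A 1 1 * v 1 := by
  simp [lat2, PiLp.ext_iff, Fin.forall_fin_two]

theorem one_le_abs_planeDet {A : Matrix (Fin 2) (Fin 2) ℝ} (hA : |A.det| = 1)
    {x y : EuclideanSpace ℝ (Fin 2)} (hx : x ∈ lat2 A) (hy : y ∈ lat2 A)
    (hxy : planeDet x y ≠ 0) : 1 ≤ |planeDet x y| := by
  obtain ⟨v, hv0, hv1⟩ := mem_lat2_iff.mp hx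
  obtain ⟨w, hw0, hw1⟩ := mem_lat2_iff.mp hy
  have h : planeDet x y = A.det * ((v 0 * w 1 - v 1 * w 0 : ℤ) : ℝ) := by
    rw [planeDet, hv0, hv1, hw0, hw1, Matrix.det_fin_two]
    push_cast
    ring
  have hne : v 0 * w 1 - v 1 * w 0 ≠ 0 := by
    intro h0
    simp [h, h0] at hxy
  rw [h, abs_mul, hA, one_mul]
  exact_mod_cast Int.one_le_abs hne

theorem exists_pos_forall_le_norm {A : Matrix (Fin 2) (Fin 2) ℝ} (hA : |A.det| = 1) :
    ∃ c > 0, ∀ x ∈ lat2 A, x ≠ 0 → c ≤ ‖x‖ := by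
  set a : EuclideanSpace ℝ (Fin 2) := !₂[A 0 0, A 1 0] with ha
  set b : EuclideanSpace ℝ (Fin 2) := !₂[A 0 1, A 1 1] with hb
  have ha_mem : a ∈ lat2 A := mem_lat2_iff.mpr ⟨![1, 0], by simp [ha]⟩
  have hb_mem : b ∈ lat2 A := mem_lat2_iff.mpr ⟨![0, 1], by simp [hb]⟩
  refine ⟨(‖a‖ + ‖b‖ + 1)⁻¹, by positivity, fun x hx hx0 => ?_⟩
  have key : ∀ y ∈ lat2 A, planeDet x y ≠ 0 → ‖y‖ ≤ ‖a‖ + ‖b‖ + 1 →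
      (‖a‖ + ‖b‖ + 1)⁻¹ ≤ ‖x‖ := by
    intro y hy hxy hle
    rw [inv_le_iff_one_le_mul₀ (by positivity)]
    calc (1 : ℝ) ≤ |planeDet x y| := one_le_abs_planeDet hA hx hy hxy
      _ ≤ ‖x‖ * ‖y‖ := abs_planeDet_le x y
      _ ≤ _ := by gcongr
  by_cases h1 : planeDet x a = 0
  · by_cases h2 : planeDet x b = 0
    · have hdet : A.det ≠ 0 := by
        intro h
        simp [h] at hA
      simp only [planeDet, ha, hb, PiLp.toLp_apply, Matrix.cons_val_zero,
        Matrix.cons_val_one] at h1 h2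
      rw [Matrix.det_fin_two] at hdet
      have e0 : x 0 = 0 := (mul_eq_zero.mp (by linear_combination A 0 0 * h2 - A 0 1 * h1 :
        (A 0 0 * A 1 1 - A 0 1 * A 1 0) * x 0 = 0)).resolve_left hdet
      have e1 : x 1 = 0 := (mul_eq_zero.mp (by linear_combination A 1 0 * h2 - A 1 1 * h1 :
        (A 0 0 * A 1 1 - A 0 1 * A 1 0) * x 1 = 0)).resolve_left hdet
      exact absurd (by simp [PiLp.ext_iff, Fin.forall_fin_two, e0, e1]) hx0
    · exact key b hb_mem h2 (by linarith [norm_nonneg a])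
  · exact key a ha_mem h1 (by linarith [norm_nonneg b])

theorem setMinNorm_le {E : Type*} [NormedAddCommGroup E] {L : Set E} {x : E} (hx : x ∈ L)
    (hx0 : x ≠ 0) : setMinNorm L ≤ ‖x‖ :=
  csInf_le ⟨0, by rintro _ ⟨y, -, -, rfl⟩; exact norm_nonneg y⟩ ⟨x, hx, hx0, rfl⟩

theorem setMinNorm_lat2_pos {A : Matrix (Fin 2) (Fin 2) ℝ} (hA : |A.det| = 1) :
    0 < setMinNorm (lat2 A) := by
  obtain ⟨c, hc, h⟩ := exists_pos_forall_le_norm hA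
  refine hc.trans_le (le_csInf ?_ (by rintro _ ⟨x, hx, hx0, rfl⟩; exact h x hx hx0))
  refine ⟨_, !₂[A 0 0, A 1 0], mem_lat2_iff.mpr ⟨![1, 0], by simp⟩, fun h0 => ?_, rfl⟩
  have e0 : A 0 0 = 0 := by simpa using congrArg (fun x => x 0) h0
  have e1 : A 1 0 = 0 := by simpa using congrArg (fun x => x 1) h0
  simp [Matrix.det_fin_two, e0, e1] at hA

/-- Let `L = A·ℤ²` be a lattice of covolume 1 in `ℝ²` with `‖L‖ < 1` and `l ∈ L` with
`‖l‖ = ‖L‖`. For every `k ∈ ℤ` with `e^{|k|}·‖L‖ < 1`, one has `‖δ_k L‖ = ‖δ_k l‖`. -/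
theorem stmt5 (A : Matrix (Fin 2) (Fin 2) ℝ) (hA : |A.det| = 1)
    (hnorm : setMinNorm (lat2 A) < 1)
    (l : EuclideanSpace ℝ (Fin 2)) (hl : l ∈ lat2 A)
    (hlnorm : ‖l‖ = setMinNorm (lat2 A))
    (k : ℤ) (hk : Real.exp |(k : ℝ)| * setMinNorm (lat2 A) < 1) :
    setMinNorm (diag2 (k : ℝ) '' lat2 A) = ‖diag2 (k : ℝ) l‖ := by
  have hl0 : l ≠ 0 := norm_pos_iff.mp (hlnorm ▸ setMinNorm_lat2_pos hA)
  refine IsLeast.csInf_eq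
    ⟨⟨_, Set.mem_image_of_mem _ hl, diag2_eq_zero_iff.not.mpr hl0, rfl⟩, ?_⟩
  rintro _ ⟨_, ⟨x, hx, rfl⟩, hx0, rfl⟩
  rw [Ne, diag2_eq_zero_iff] at hx0
  by_cases hdet : planeDet l x = 0
  · exact norm_diag2_le_norm_diag2 hdet hx0 (hlnorm ▸ setMinNorm_le hx hx0) k
  · have hlt : ‖diag2 (k : ℝ) l‖ < 1 := (norm_diag2_le k l).trans_lt (hlnorm ▸ hk)
    have hmul : 1 ≤ ‖diag2 (k : ℝ) l‖ * ‖diag2 (k : ℝ) x‖ :=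
      calc (1 : ℝ) ≤ |planeDet l x| := one_le_abs_planeDet hA hl hx hdet
        _ = |planeDet (diag2 (k : ℝ) l) (diag2 (k : ℝ) x)| := by rw [planeDet_diag2]
        _ ≤ _ := abs_planeDet_le _ _
    nlinarith [norm_nonneg (diag2 (k : ℝ) x)]
end
end

section
/- There exists a real number a₀ such that for every a ≥ a₀, μ₂({L ∈ 𝒮₂ : ‖L‖^{−2} > a}) = (3/π)·a^{−1}. -/
noncomputable section

open MeasureTheory

/-- `SL_d(ℝ)`. -/
abbrev SLR (d : ℕ) := Matrix.SpecialLinearGroup (Fin d) ℝ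

/-- `SL_d(ℤ)` viewed as a subgroup of `SL_d(ℝ)` (the range of the coefficientwise
integer-cast homomorphism `SL_d(ℤ) →* SL_d(ℝ)`). -/
def SLZ (d : ℕ) : Subgroup (SLR d) :=
  (Matrix.SpecialLinearGroup.map (n := Fin d) (Int.castRingHom ℝ)).range

instance (d : ℕ) : MeasurableSpace (Matrix (Fin d) (Fin d) ℝ) :=
  inferInstanceAs (MeasurableSpace (Fin d → Fin d → ℝ))

instance (d : ℕ) : MeasurableSpace (SLR d) :=
  inferInstanceAs (MeasurableSpace {A : Matrix (Fin d) (Fin d) ℝ // A.det = 1})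

/-- The space of unimodular lattices `𝒮_d = SL_d(ℝ)/SL_d(ℤ)`; the coset of
`g ∈ SL_d(ℝ)` corresponds to the lattice `g·ℤ^d`. -/
abbrev LatticeSpace (d : ℕ) := SLR d ⧸ SLZ d

/-- The vector `g·v ∈ ℝ^d` for `g ∈ SL_d(ℝ)` and `v ∈ ℤ^d`: a point of the
lattice `g·ℤ^d`. -/
def latVec {d : ℕ} (g : SLR d) (v : Fin d → ℤ) : EuclideanSpace ℝ (Fin d) :=
  (WithLp.equiv 2 (Fin d → ℝ)).symm (g.1.mulVec fun i => (v i : ℝ))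

/-- The minimal norm `‖L‖ = inf {‖l‖ : l ∈ L ∖ {0}}` of the lattice `L = g·ℤ^d`. -/
def gMin {d : ℕ} (g : SLR d) : ℝ :=
  sInf {r : ℝ | ∃ v : Fin d → ℤ, latVec g v ≠ 0 ∧ ‖latVec g v‖ = r}

open scoped ENNReal Matrix

/-! ### The measure counting primitive lattice points -/

/-- Primitive integer vectors of the plane. -/
abbrev PrimVec := {v : Fin 2 → ℤ // IsCoprime (v 0) (v 1)}

/-- The plane `ℝ²`. -/
abbrev Plane := Fin 2 → ℝ

/-- The open disc of radius `|r|` centred at the origin. -/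
def disc (r : ℝ) : Set Plane := {p | p 0 ^ 2 + p 1 ^ 2 < r ^ 2}

/-- The lattice point of `g·ℤ²` with integer coordinates `v`. -/
def latPt (g : SLR 2) (v : Fin 2 → ℤ) : Plane := g.1 *ᵥ fun i => (v i : ℝ)

lemma measurableSet_disc (r : ℝ) : MeasurableSet (disc r) :=
  measurableSet_lt (by fun_prop) measurable_const

lemma latPt_zero_apply (g : SLR 2) (v : Fin 2 → ℤ) :
    latPt g v 0 = g.1 0 0 * v 0 + g.1 0 1 * v 1 := by
  simp [latPt, Matrix.mulVec, dotProduct, Fin.sum_univ_two]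

lemma latPt_one_apply (g : SLR 2) (v : Fin 2 → ℤ) :
    latPt g v 1 = g.1 1 0 * v 0 + g.1 1 1 * v 1 := by
  simp [latPt, Matrix.mulVec, dotProduct, Fin.sum_univ_two]

lemma latPt_mul (g h : SLR 2) (v : Fin 2 → ℤ) : latPt (g * h) v = g.1 *ᵥ latPt h v := by
  change (g.1 * h.1) *ᵥ _ = _
  rw [latPt, Matrix.mulVec_mulVec]

lemma latPt_mul_intCast (g : SLR 2) (γ : Matrix.SpecialLinearGroup (Fin 2) ℤ) (v : Fin 2 → ℤ) :
    latPt (g * Matrix.SpecialLinearGroup.map (Int.castRingHom ℝ) γ) v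
      = latPt g (γ.1 *ᵥ v) := by
  rw [latPt_mul]
  unfold latPt
  congr 1
  ext i
  simp [Matrix.mulVec, dotProduct, Fin.sum_univ_two]

/-- The action of `SL₂(ℤ)` on primitive vectors. -/
def primEquiv (γ : Matrix.SpecialLinearGroup (Fin 2) ℤ) : PrimVec ≃ PrimVec where
  toFun v := ⟨γ.1 *ᵥ v.1, v.2.mulVecSL γ⟩
  invFun v := ⟨(γ⁻¹).1 *ᵥ v.1, v.2.mulVecSL γ⁻¹⟩
  left_inv v := by
    have h : (γ⁻¹).1 * γ.1 = 1 := congrArg Subtype.val (inv_mul_cancel γ)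
    exact Subtype.ext ((Matrix.mulVec_mulVec _ _ _).trans (by rw [h, Matrix.one_mulVec]))
  right_inv v := by
    have h : γ.1 * (γ⁻¹).1 = 1 := congrArg Subtype.val (mul_inv_cancel γ)
    exact Subtype.ext ((Matrix.mulVec_mulVec _ _ _).trans (by rw [h, Matrix.one_mulVec]))

/-- The counting measure on the primitive vectors of `g·ℤ²`. -/
def primMeasure (g : SLR 2) : Measure Plane :=
  Measure.sum fun v : PrimVec => Measure.dirac (latPt g v.1)

lemma primMeasure_apply (g : SLR 2) {s : Set Plane} (hs : MeasurableSet s) :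
    primMeasure g s = ∑' v : PrimVec, s.indicator 1 (latPt g v.1) := by
  simp [primMeasure, Measure.sum_apply, hs, Measure.dirac_apply']

lemma primMeasure_mul_mem (g γ : SLR 2) (hγ : γ ∈ SLZ 2) :
    primMeasure (g * γ) = primMeasure g := by
  obtain ⟨γ, rfl⟩ := hγ
  ext s hs
  simp only [primMeasure_apply _ hs, latPt_mul_intCast]
  exact (primEquiv γ).tsum_eq fun v => s.indicator (1 : Plane → ℝ≥0∞) (latPt g v.1)

/-- The counting measure on the primitive vectors of a lattice. -/
def latMeasure (L : LatticeSpace 2) : Measure Plane :=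
  Quotient.liftOn' L primMeasure fun g h hgh => by
    rw [QuotientGroup.leftRel_apply] at hgh
    rw [← primMeasure_mul_mem g _ hgh, mul_inv_cancel_left]

lemma measurable_SLR_apply (i j : Fin 2) : Measurable fun g : SLR 2 => g.1 i j :=
  have h : Measurable fun A : Matrix (Fin 2) (Fin 2) ℝ => A i j :=
    (measurable_pi_apply (X := fun _ : Fin 2 => ℝ) j).comp
      (measurable_pi_apply (X := fun _ : Fin 2 => Fin 2 → ℝ) i)
  h.comp measurable_subtype_coe

lemma measurable_latPt (v : Fin 2 → ℤ) : Measurable fun g : SLR 2 => latPt g v := by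
  refine measurable_pi_lambda _ fun i => ?_
  simp only [latPt, Matrix.mulVec, dotProduct]
  exact Finset.measurable_sum _ fun j _ => (measurable_SLR_apply i j).mul_const _

lemma measurable_latMeasure : Measurable latMeasure := by
  refine Measure.measurable_of_measurable_coe _ fun s hs => ?_
  refine QuotientGroup.measurable_from_quotient.2 ?_
  have : (fun L => latMeasure L s) ∘ (QuotientGroup.mk : SLR 2 → LatticeSpace 2) =
      fun g => ∑' v : PrimVec, s.indicator 1 (latPt g v.1) := by
    ext g
    exact primMeasure_apply g hs
  rw [this]
  exact Measurable.tsum fun v => (measurable_one.indicator hs).comp (measurable_latPt v.1)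

lemma measurable_SLR_mul_left (g : SLR 2) : Measurable fun h : SLR 2 => g * h := by
  refine Measurable.subtype_mk (measurable_pi_lambda _ fun i => measurable_pi_lambda _ fun j => ?_)
  simp only [Matrix.mul_apply]
  exact Finset.measurable_sum _ fun k _ => (measurable_SLR_apply k j).const_mul _

lemma measurable_lattice_smul (g : SLR 2) : Measurable fun L : LatticeSpace 2 => g • L :=
  QuotientGroup.measurable_from_quotient.2
    (QuotientGroup.measurable_coe.comp (measurable_SLR_mul_left g))

lemma measurable_mulVec (g : SLR 2) : Measurable fun p : Plane => g.1 *ᵥ p := by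
  refine measurable_pi_lambda _ fun i => ?_
  simp only [Matrix.mulVec, dotProduct]
  fun_prop

lemma latMeasure_smul (g : SLR 2) (L : LatticeSpace 2) {s : Set Plane} (hs : MeasurableSet s) :
    latMeasure (g • L) s = latMeasure L ((g.1 *ᵥ ·) ⁻¹' s) := by
  induction L using QuotientGroup.induction_on with
  | H h =>
    change primMeasure (g * h) s = primMeasure h _
    rw [primMeasure_apply _ hs, primMeasure_apply _ (measurable_mulVec g hs)]
    simp only [latPt_mul]
    rfl

/-- The average over `μ` of the counting measures on primitive vectors. -/
def siegelMeasure (μ : Measure (LatticeSpace 2)) : Measure Plane := μ.bind latMeasure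

lemma siegelMeasure_apply (μ : Measure (LatticeSpace 2)) {s : Set Plane} (hs : MeasurableSet s) :
    siegelMeasure μ s = ∫⁻ L, latMeasure L s ∂μ :=
  Measure.bind_apply hs measurable_latMeasure.aemeasurable

lemma measurePreserving_siegelMeasure (μ : Measure (LatticeSpace 2))
    (hinv : ∀ (g : SLR 2) (s : Set (LatticeSpace 2)), μ ((g • ·) ⁻¹' s) = μ s) (g : SLR 2) :
    MeasurePreserving (fun p : Plane => g.1 *ᵥ p) (siegelMeasure μ) (siegelMeasure μ) := by
  refine ⟨measurable_mulVec g, ?_⟩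
  ext s hs
  have hμ : MeasurePreserving (fun L : LatticeSpace 2 => g • L) μ μ :=
    ⟨measurable_lattice_smul g, by
      ext t ht
      rw [Measure.map_apply (measurable_lattice_smul g) ht, hinv]⟩
  rw [Measure.map_apply (measurable_mulVec g) hs, siegelMeasure_apply _ hs,
    siegelMeasure_apply _ (measurable_mulVec g hs)]
  refine Eq.trans ?_ (hμ.lintegral_comp ((Measure.measurable_coe hs).comp measurable_latMeasure))
  exact lintegral_congr fun L => (latMeasure_smul g L hs).symm

/-! ### `SL₂(ℝ)`-invariant measures on the plane are homogeneous -/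

/-- The upper unipotent matrix with off-diagonal entry `t`. -/
def upperShear (t : ℝ) : SLR 2 := ⟨!![1, t; 0, 1], by simp [Matrix.det_fin_two]⟩

/-- The lower unipotent matrix with off-diagonal entry `t`. -/
def lowerShear (t : ℝ) : SLR 2 := ⟨!![1, 0; t, 1], by simp [Matrix.det_fin_two]⟩

/-- The diagonal matrix with entries `s` and `s⁻¹`. -/
def diagSL (s : ℝ) (hs : s ≠ 0) : SLR 2 :=
  ⟨!![s, 0; 0, s⁻¹], by simp [Matrix.det_fin_two, hs]⟩

lemma upperShear_mulVec (t : ℝ) (p : Plane) :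
    (upperShear t).1 *ᵥ p = ![p 0 + t * p 1, p 1] := by
  ext i
  fin_cases i <;> simp [upperShear, Matrix.mulVec, dotProduct, Fin.sum_univ_two]

lemma lowerShear_mulVec (t : ℝ) (p : Plane) :
    (lowerShear t).1 *ᵥ p = ![p 0, t * p 0 + p 1] := by
  ext i
  fin_cases i <;> simp [lowerShear, Matrix.mulVec, dotProduct, Fin.sum_univ_two]

lemma diagSL_mulVec (s : ℝ) (hs : s ≠ 0) (p : Plane) :
    (diagSL s hs).1 *ᵥ p = ![s * p 0, s⁻¹ * p 1] := by
  ext i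
  fin_cases i <;> simp [diagSL, Matrix.mulVec, dotProduct, Fin.sum_univ_two]

lemma exists_diagSL_upperShear_mem_disc (p : Plane) (hp : p 1 ≠ 0) :
    ∃ (n : ℕ) (j : ℤ), (diagSL (n + 1) n.cast_add_one_ne_zero).1 *ᵥ
      ((upperShear (j / (n + 1) ^ 2)).1 *ᵥ p) ∈ disc (1 / 2) := by
  obtain ⟨n, hn⟩ := exists_nat_gt (5 * p 1 ^ 2)
  refine ⟨n, -round (p 0 * (n + 1) ^ 2 / p 1), ?_⟩
  have hN : (0 : ℝ) < n + 1 := by positivity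
  have hr := abs_sub_round (p 0 * (n + 1) ^ 2 / p 1)
  set w := p 0 * (n + 1) ^ 2 / p 1 with hw
  set e := w - round w with he
  have h1 : (n + 1) * (p 0 + ((-round w : ℤ) : ℝ) / (n + 1) ^ 2 * p 1) = e * p 1 / (n + 1) := by
    have : p 0 = w * p 1 / (n + 1) ^ 2 := by rw [hw]; field_simp
    rw [this, he]
    push_cast
    field_simp
    ring
  have he2 : e ^ 2 ≤ 1 / 4 := by
    have := abs_le.1 hr
    nlinarith
  rw [upperShear_mulVec, diagSL_mulVec]
  simp only [disc, Set.mem_ofPred_eq, Matrix.cons_val_zero, Matrix.cons_val_one]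
  rw [h1]
  have h2 : (e * p 1 / (n + 1)) ^ 2 + ((n + 1 : ℝ)⁻¹ * p 1) ^ 2
      = (e ^ 2 + 1) * p 1 ^ 2 / (n + 1) ^ 2 := by
    field_simp
  rw [h2, div_lt_iff₀ (by positivity)]
  nlinarith [sq_nonneg (p 1), sq_nonneg (n : ℝ)]

lemma exists_diagSL_inv_mem_disc (p : Plane) (hp : p 1 = 0) :
    ∃ n : ℕ, (diagSL (n + 1 : ℝ)⁻¹ (inv_ne_zero n.cast_add_one_ne_zero)).1 *ᵥ p
      ∈ disc (1 / 2) := by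
  obtain ⟨n, hn⟩ := exists_nat_gt (4 * p 0 ^ 2)
  refine ⟨n, ?_⟩
  rw [diagSL_mulVec]
  simp only [disc, Set.mem_ofPred_eq, Matrix.cons_val_zero, Matrix.cons_val_one, hp]
  have h2 : ((n + 1 : ℝ)⁻¹ * p 0) ^ 2 + ((n + 1 : ℝ)⁻¹⁻¹ * 0) ^ 2 = p 0 ^ 2 / (n + 1) ^ 2 := by
    field_simp
    ring
  rw [h2, div_lt_iff₀ (by positivity)]
  nlinarith [sq_nonneg (n : ℝ)]

/-- Invariance of a measure on the plane under the linear action of `SL₂(ℝ)`. -/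
def SLInvariant (ν : Measure Plane) : Prop :=
  ∀ g : SLR 2, MeasurePreserving (fun p : Plane => g.1 *ᵥ p) ν ν

lemma sigmaFinite_of_invariant {ν : Measure Plane} (hν : SLInvariant ν)
    (hfin : ν (disc (1 / 2)) < ∞) : SigmaFinite ν := by
  refine Measure.sigmaFinite_of_countable (S :=
    (Set.range fun q : ℕ × ℤ => (fun p : Plane => (diagSL (q.1 + 1)
      q.1.cast_add_one_ne_zero).1 *ᵥ ((upperShear (q.2 / (q.1 + 1) ^ 2)).1 *ᵥ p)) ⁻¹'
        disc (1 / 2)) ∪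
    (Set.range fun n : ℕ => (fun p : Plane => (diagSL (n + 1 : ℝ)⁻¹
      (inv_ne_zero n.cast_add_one_ne_zero)).1 *ᵥ p) ⁻¹' disc (1 / 2)))
    ((Set.countable_range _).union (Set.countable_range _)) ?_ ?_
  · rintro s (⟨q, rfl⟩ | ⟨n, rfl⟩)
    · have := ((hν (diagSL (q.1 + 1) q.1.cast_add_one_ne_zero)).comp
        (hν (upperShear (q.2 / (q.1 + 1) ^ 2)))).measure_preimage
          (measurableSet_disc (1 / 2)).nullMeasurableSet
      exact this.trans_lt hfin
    · exact ((hν _).measure_preimage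
        (measurableSet_disc (1 / 2)).nullMeasurableSet).trans_lt hfin
  · refine Set.eq_univ_of_forall fun p => ?_
    by_cases hp : p 1 = 0
    · obtain ⟨n, hn⟩ := exists_diagSL_inv_mem_disc p hp
      exact ⟨_, Or.inr ⟨n, rfl⟩, hn⟩
    · obtain ⟨n, j, hn⟩ := exists_diagSL_upperShear_mem_disc p hp
      exact ⟨_, Or.inl ⟨(n, j), rfl⟩, hn⟩

lemma measure_axis_eq_zero {ν : Measure Plane} (hν : SLInvariant ν) [SigmaFinite ν]
    (h0 : ν {0} = 0) : ν {p : Plane | p 1 = 0} = 0 := by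
  let ℓ : ℝ → Set Plane := fun t => {p | p 1 = t * p 0 ∧ p 0 ≠ 0}
  have hℓm : ∀ t, MeasurableSet (ℓ t) := fun t =>
    (measurableSet_eq_fun (by fun_prop) (by fun_prop)).inter
      (measurableSet_eq_fun (by fun_prop) measurable_const).compl
  have hℓ : ∀ t, ν (ℓ t) = ν (ℓ 0) := fun t => by
    rw [← (hν (lowerShear t)).measure_preimage (hℓm t).nullMeasurableSet]
    congr 1
    ext p
    simp only [ℓ, Set.mem_preimage, lowerShear_mulVec]
    simp
  have hdisj : Pairwise (Function.onFun Disjoint ℓ) := fun s t hst =>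
    Set.disjoint_left.2 fun p hs ht =>
      hst (mul_right_cancel₀ hs.2 (hs.1.symm.trans ht.1))
  have hzero : ν (ℓ 0) = 0 := by
    by_contra hne
    have hc := Measure.countable_meas_pos_of_disjoint_iUnion (μ := ν) hℓm hdisj
    have huniv : {t | 0 < ν (ℓ t)} = Set.univ :=
      Set.eq_univ_of_forall fun t => by
        simpa [hℓ t] using pos_iff_ne_zero.2 hne
    exact Set.not_countable_univ (huniv ▸ hc)
  refine measure_mono_null (t := ℓ 0 ∪ {0}) (fun p hp => ?_) (measure_union_null hzero h0)
  by_cases hx : p 0 = 0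
  · right
    ext i
    fin_cases i
    exacts [hx, hp]
  · left
    exact ⟨by simpa using hp, hx⟩

/-- The length of `E` along the horizontal line through `p`, in units of the height of `p`. -/
def sliceLength (E : Set Plane) (p : Plane) : ℝ≥0∞ :=
  ∫⁻ t : ℝ, E.indicator 1 ![p 0 - t * p 1, p 1]

lemma measurable_indicator_slice {E : Set Plane} (hE : MeasurableSet E) :
    Measurable fun q : Plane × ℝ =>
      E.indicator (1 : Plane → ℝ≥0∞) ![q.1 0 - q.2 * q.1 1, q.1 1] := by
  refine (measurable_one.indicator hE).comp (measurable_pi_lambda _ fun i => ?_)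
  fin_cases i
  · simp only [Fin.zero_eta, Matrix.cons_val_zero]; fun_prop
  · simp only [Fin.mk_one, Matrix.cons_val_one]; fun_prop

lemma measurable_sliceLength {E : Set Plane} (hE : MeasurableSet E) :
    Measurable (sliceLength E) :=
  (measurable_indicator_slice hE).lintegral_prod_right'

lemma measure_mul_eq_lintegral_sliceLength {ν : Measure Plane} (hν : SLInvariant ν)
    [SigmaFinite ν] (hax : ν {p : Plane | p 1 = 0} = 0)
    {E : Set Plane} (hE : MeasurableSet E) (w : ℝ) :
    ENNReal.ofReal w * ν E =
      ∫⁻ p, (Set.Ico 0 w).indicator 1 (p 0 / p 1) * sliceLength E p ∂ν := by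
  have hW : Measurable ((Set.Ico 0 w).indicator (1 : ℝ → ℝ≥0∞)) :=
    measurable_one.indicator measurableSet_Ico
  have hIE : Measurable (E.indicator (1 : Plane → ℝ≥0∞)) := measurable_one.indicator hE
  have hu : Measurable fun p : Plane => p 0 / p 1 := by fun_prop
  have hae : ∀ᵐ p ∂ν, p 1 ≠ 0 := by
    rw [ae_iff]
    simpa using hax
  calc ENNReal.ofReal w * ν E
      = ∫⁻ p, (∫⁻ t : ℝ, E.indicator 1 p * (Set.Ico 0 w).indicator 1 (p 0 / p 1 + t)) ∂ν := by
        have : ∀ p : Plane, ∫⁻ t : ℝ, E.indicator 1 p * (Set.Ico 0 w).indicator 1 (p 0 / p 1 + t)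
            = E.indicator 1 p * ENNReal.ofReal w := fun p => by
          rw [lintegral_const_mul _ (f := fun t : ℝ => (Set.Ico 0 w).indicator 1 (p 0 / p 1 + t))
              (hW.comp (measurable_const_add _)),
            lintegral_add_left_eq_self (μ := volume)
              (fun t => (Set.Ico 0 w).indicator (1 : ℝ → ℝ≥0∞) t) (p 0 / p 1),
            lintegral_indicator_one measurableSet_Ico, Real.volume_Ico, sub_zero]
        simp_rw [this]
        rw [lintegral_mul_const _ hIE, lintegral_indicator_one hE, mul_comm]
    _ = ∫⁻ t : ℝ, ∫⁻ p, E.indicator 1 p * (Set.Ico 0 w).indicator 1 (p 0 / p 1 + t) ∂ν := by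
        refine lintegral_lintegral_swap (Measurable.aemeasurable ?_)
        exact (hIE.comp measurable_fst).mul
          (hW.comp ((hu.comp measurable_fst).add measurable_snd))
    _ = ∫⁻ t : ℝ, ∫⁻ p, (Set.Ico 0 w).indicator 1 (p 0 / p 1) *
          E.indicator 1 ![p 0 - t * p 1, p 1] ∂ν := by
        refine lintegral_congr fun t => ?_
        rw [← (hν (upperShear (-t))).lintegral_comp (f := fun p : Plane => E.indicator 1 p *
          (Set.Ico 0 w).indicator 1 (p 0 / p 1 + t)) (hIE.mul (hW.comp (hu.add_const t)))]
        refine lintegral_congr_ae ?_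
        filter_upwards [hae] with p hp
        have h1 : (p 0 - t * p 1) / p 1 + t = p 0 / p 1 := by field_simp; ring
        simp only [upperShear_mulVec, Matrix.cons_val_zero, Matrix.cons_val_one, neg_mul,
          ← sub_eq_add_neg]
        rw [h1, mul_comm]
    _ = ∫⁻ p, (∫⁻ t : ℝ, (Set.Ico 0 w).indicator 1 (p 0 / p 1) *
          E.indicator 1 ![p 0 - t * p 1, p 1]) ∂ν := by
        refine (lintegral_lintegral_swap (Measurable.aemeasurable ?_)).symm
        exact (hW.comp (hu.comp measurable_fst)).mul (measurable_indicator_slice hE)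
    _ = _ := by
        refine lintegral_congr fun p => ?_
        exact lintegral_const_mul _ ((measurable_indicator_slice hE).comp measurable_prodMk_left)

lemma sliceLength_dilation (E : Set Plane) {s : ℝ} (hs : s ≠ 0) (p : Plane) (hp : p 1 ≠ 0) :
    sliceLength ((fun p : Plane => s⁻¹ • p) ⁻¹' E) p
      = sliceLength E ((diagSL s hs).1 *ᵥ p) := by
  unfold sliceLength
  rw [← lintegral_add_right_eq_self (μ := volume) _ ((1 - s ^ 2) * (p 0 / p 1))]
  refine lintegral_congr fun t => ?_
  have h : (fun p : Plane => s⁻¹ • p) ![p 0 - (t + (1 - s ^ 2) * (p 0 / p 1)) * p 1, p 1]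
      = ![((diagSL s hs).1 *ᵥ p) 0 - t * ((diagSL s hs).1 *ᵥ p) 1, ((diagSL s hs).1 *ᵥ p) 1] := by
    rw [diagSL_mulVec]
    ext i
    fin_cases i
    · simp
      field_simp
      ring
    · simp
  rw [← h]
  rfl

theorem measure_dilation {ν : Measure Plane} (hν : SLInvariant ν)
    [SigmaFinite ν] (h0 : ν {0} = 0) {E : Set Plane}
    (hE : MeasurableSet E) {s : ℝ} (hs : 0 < s) :
    ν ((fun p : Plane => s⁻¹ • p) ⁻¹' E) = ENNReal.ofReal (s ^ 2) * ν E := by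
  have hax := measure_axis_eq_zero hν h0
  have hae : ∀ᵐ p ∂ν, p 1 ≠ 0 := by
    rw [ae_iff]
    simpa using hax
  have hE' : MeasurableSet ((fun p : Plane => s⁻¹ • p) ⁻¹' E) :=
    (measurable_const_smul s⁻¹) hE
  have hW : Measurable ((Set.Ico 0 (s ^ 2)).indicator (1 : ℝ → ℝ≥0∞)) :=
    measurable_one.indicator measurableSet_Ico
  have hm : Measurable fun p : Plane =>
      (Set.Ico 0 (s ^ 2)).indicator (1 : ℝ → ℝ≥0∞) (p 0 / p 1) * sliceLength E p :=
    (hW.comp (by fun_prop)).mul (measurable_sliceLength hE)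
  rw [measure_mul_eq_lintegral_sliceLength hν hax hE (s ^ 2),
    ← (hν (diagSL s hs.ne')).lintegral_comp hm, ← one_mul (ν _), ← ENNReal.ofReal_one,
    measure_mul_eq_lintegral_sliceLength hν hax hE' 1]
  refine lintegral_congr_ae ?_
  filter_upwards [hae] with p hp
  rw [sliceLength_dilation E hs.ne' p hp]
  congr 1
  have h1 : ((diagSL s hs.ne').1 *ᵥ p) 0 / ((diagSL s hs.ne').1 *ᵥ p) 1
      = s ^ 2 * (p 0 / p 1) := by
    rw [diagSL_mulVec]
    simp
    field_simp
  rw [h1]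
  have h2 : s ^ 2 * (p 0 / p 1) ∈ Set.Ico 0 (s ^ 2) ↔ p 0 / p 1 ∈ Set.Ico (0 : ℝ) 1 := by
    have := pow_pos hs 2
    rw [Set.mem_Ico, Set.mem_Ico, mul_nonneg_iff_of_pos_left this, mul_lt_iff_lt_one_right this]
  by_cases h : p 0 / p 1 ∈ Set.Ico (0 : ℝ) 1
  · rw [Set.indicator_of_mem h, Set.indicator_of_mem (h2.2 h)]
    rfl
  · rw [Set.indicator_of_notMem h, Set.indicator_of_notMem (mt h2.1 h)]

/-! ### Counting lattice points in discs -/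

lemma latPt_cross (g : SLR 2) (v w : Fin 2 → ℤ) :
    latPt g v 0 * latPt g w 1 - latPt g v 1 * latPt g w 0 = ((v 0 * w 1 - v 1 * w 0 : ℤ) : ℝ) := by
  have hdet : g.1 0 0 * g.1 1 1 - g.1 0 1 * g.1 1 0 = 1 := by
    rw [← Matrix.det_fin_two]; exact g.2
  simp only [latPt_zero_apply, latPt_one_apply]
  push_cast
  linear_combination (v 0 * w 1 - v 1 * w 0 : ℝ) * hdet

lemma latPt_neg (g : SLR 2) (v : Fin 2 → ℤ) : latPt g (-v) = -latPt g v := by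
  ext i
  fin_cases i <;> simp [latPt_zero_apply, latPt_one_apply] <;> ring

lemma latPt_sub (g : SLR 2) (v w : Fin 2 → ℤ) : latPt g (v - w) = latPt g v - latPt g w := by
  ext i
  fin_cases i <;> simp [latPt_zero_apply, latPt_one_apply] <;> ring

lemma latPt_nsmul (g : SLR 2) (k : ℕ) (v : Fin 2 → ℤ) :
    latPt g (k • v) = (k : ℝ) • latPt g v := by
  ext i
  fin_cases i <;> simp [latPt_zero_apply, latPt_one_apply] <;> ring

lemma neg_mem_disc {r : ℝ} {p : Plane} (hp : p ∈ disc r) : -p ∈ disc r := by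
  simpa [disc] using hp

lemma smul_mem_disc_iff {k r : ℝ} (hk : 0 < k) (p : Plane) :
    k • p ∈ disc r ↔ p ∈ disc (r / k) := by
  simp only [disc, Set.mem_ofPred_eq, Pi.smul_apply, smul_eq_mul, div_pow]
  rw [lt_div_iff₀ (by positivity)]
  ring_nf

lemma eq_or_eq_neg_of_cross_eq_zero {v w : PrimVec} (h : v.1 0 * w.1 1 - v.1 1 * w.1 0 = 0) :
    w.1 = v.1 ∨ w.1 = -v.1 := by
  obtain ⟨a, b, hab⟩ := v.2
  obtain ⟨c, d, hcd⟩ := w.2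
  set k := a * w.1 0 + b * w.1 1 with hk
  have h0 : w.1 0 = k * v.1 0 := by rw [hk]; linear_combination (-w.1 0) * hab - b * h
  have h1 : w.1 1 = k * v.1 1 := by rw [hk]; linear_combination (-w.1 1) * hab + a * h
  have hunit : k * (c * v.1 0 + d * v.1 1) = 1 := by
    rw [← hcd, h0, h1]; ring
  rcases Int.eq_one_or_neg_one_of_mul_eq_one hunit with hk1 | hk1
  · left
    ext i
    fin_cases i
    · simpa [hk1] using h0
    · simpa [hk1] using h1
  · right
    ext i
    fin_cases i
    · simpa [hk1] using h0
    · simpa [hk1] using h1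

lemma eq_or_eq_neg_of_mem_disc {g : SLR 2} {r : ℝ} (hr : r ^ 2 ≤ 1) {v w : PrimVec}
    (hv : latPt g v.1 ∈ disc r) (hw : latPt g w.1 ∈ disc r) : w.1 = v.1 ∨ w.1 = -v.1 := by
  apply eq_or_eq_neg_of_cross_eq_zero
  have hc := latPt_cross g v.1 w.1
  simp only [disc, Set.mem_ofPred_eq] at hv hw
  set z : ℤ := v.1 0 * w.1 1 - v.1 1 * w.1 0
  have hz : (z : ℝ) ^ 2 < 1 := by
    rw [← hc]
    have h1 : (latPt g v.1 0 ^ 2 + latPt g v.1 1 ^ 2) * (latPt g w.1 0 ^ 2 + latPt g w.1 1 ^ 2)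
        < 1 * 1 := by
      apply mul_lt_mul'' (by linarith) (by linarith) <;> positivity
    nlinarith [sq_nonneg (latPt g v.1 0 * latPt g w.1 0 + latPt g v.1 1 * latPt g w.1 1)]
  have hz' : z ^ 2 < 1 := by exact_mod_cast hz
  have := (sq_lt_one_iff_abs_lt_one z).1 hz'
  exact Int.abs_lt_one_iff.1 this

lemma primVec_ne_zero (v : PrimVec) : v.1 ≠ 0 := by
  intro h
  have := v.2
  rw [h] at this
  exact not_isCoprime_zero_zero this

lemma primMeasure_disc_eq_two {g : SLR 2} {r : ℝ} (hr : r ^ 2 ≤ 1) {v : PrimVec}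
    (hv : latPt g v.1 ∈ disc r) : primMeasure g (disc r) = 2 := by
  classical
  let v' : PrimVec := ⟨-v.1, by simpa using v.2.neg_neg⟩
  have hne : v ≠ v' := fun h => primVec_ne_zero v (self_eq_neg.1 (congrArg Subtype.val h))
  have hv' : latPt g v'.1 ∈ disc r := by
    rw [latPt_neg]; exact neg_mem_disc hv
  rw [primMeasure_apply _ (measurableSet_disc r), tsum_eq_sum (s := {v, v'}),
    Finset.sum_pair hne, Set.indicator_of_mem hv, Set.indicator_of_mem hv']
  · exact one_add_one_eq_two
  · intro w hw
    refine Set.indicator_of_notMem (fun hmem => hw ?_) _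
    rcases eq_or_eq_neg_of_mem_disc hr hv hmem with h | h
    · simp [Subtype.ext h]
    · have : w = v' := Subtype.ext h
      simp [this]

lemma primMeasure_disc_ne_zero_iff {g : SLR 2} {r : ℝ} :
    primMeasure g (disc r) ≠ 0 ↔ ∃ v : PrimVec, latPt g v.1 ∈ disc r := by
  rw [primMeasure_apply _ (measurableSet_disc r), Ne, ENNReal.tsum_eq_zero]
  simp

lemma latMeasure_disc {r : ℝ} (hr : r ^ 2 ≤ 1) (L : LatticeSpace 2) :
    latMeasure L (disc r) = {L | latMeasure L (disc r) ≠ 0}.indicator (fun _ => 2) L := by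
  by_cases h : latMeasure L (disc r) = 0
  · rw [Set.indicator_of_notMem (by simpa using h), h]
  · rw [Set.indicator_of_mem h]
    induction L using QuotientGroup.induction_on with
    | H g =>
      obtain ⟨v, hv⟩ := primMeasure_disc_ne_zero_iff.1 h
      exact primMeasure_disc_eq_two hr hv

lemma measurable_latMeasure_apply {s : Set Plane} (hs : MeasurableSet s) :
    Measurable fun L : LatticeSpace 2 => latMeasure L s :=
  (Measure.measurable_coe hs).comp measurable_latMeasure

lemma siegelMeasure_disc (μ : Measure (LatticeSpace 2)) {r : ℝ} (hr : r ^ 2 ≤ 1) :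
    siegelMeasure μ (disc r) = 2 * μ {L | latMeasure L (disc r) ≠ 0} := by
  rw [siegelMeasure_apply _ (measurableSet_disc r), lintegral_congr (latMeasure_disc hr),
    lintegral_indicator_const]
  exact (measurable_latMeasure_apply (measurableSet_disc r) (measurableSet_singleton 0)).compl

lemma siegelMeasure_zero (μ : Measure (LatticeSpace 2)) : siegelMeasure μ {0} = 0 := by
  rw [siegelMeasure_apply _ (measurableSet_singleton 0)]
  refine lintegral_eq_zero_of_ae_eq_zero (Filter.Eventually.of_forall fun L => ?_)
  induction L using QuotientGroup.induction_on with
  | H g =>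
    change primMeasure g {0} = 0
    rw [primMeasure_apply _ (measurableSet_singleton 0), ENNReal.tsum_eq_zero]
    refine fun v => Set.indicator_of_notMem (fun h => ?_) _
    have h0 : latPt g v.1 = 0 := h
    obtain ⟨a, b, hab⟩ := v.2
    have hc := latPt_cross g v.1 ![-b, a]
    simp only [h0, Pi.zero_apply, zero_mul, sub_zero, Matrix.cons_val_zero,
      Matrix.cons_val_one] at hc
    have : v.1 0 * a - v.1 1 * -b = 0 := by exact_mod_cast hc.symm
    linarith

/-- Every nonzero integer vector is uniquely a positive multiple of a primitive one. -/
lemma bijective_primVec_multiple : Function.Bijective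
    fun q : PrimVec × ℕ => (⟨(q.2 + 1) • q.1.1, smul_ne_zero q.2.succ_ne_zero
      (primVec_ne_zero q.1)⟩ : {v : Fin 2 → ℤ // v ≠ 0}) := by
  have hgcd : ∀ q : PrimVec × ℕ,
      Int.gcd (((q.2 + 1) • q.1.1) 0) (((q.2 + 1) • q.1.1) 1) = q.2 + 1 := fun q => by
    have h := Int.isCoprime_iff_gcd_eq_one.1 q.1.2
    simp only [Pi.smul_apply, nsmul_eq_mul]
    rw [Int.gcd_mul_left, h, mul_one, Int.natAbs_natCast]
  constructor
  · rintro ⟨v, k⟩ ⟨w, l⟩ h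
    have h' : (k + 1) • v.1 = (l + 1) • w.1 := congrArg Subtype.val h
    have hkl : k + 1 = l + 1 := by
      have h1 := hgcd (v, k)
      have h2 := hgcd (w, l)
      simp only at h1 h2
      rw [← h1, ← h2, h']
    obtain rfl : k = l := by omega
    have : v = w := Subtype.ext (smul_right_injective _ k.succ_ne_zero h')
    rw [this]
  · rintro ⟨v, hv⟩
    have hd : 0 < Int.gcd (v 0) (v 1) := by
      refine Nat.pos_of_ne_zero fun h => hv ?_
      rw [Int.gcd_eq_zero_iff] at h
      ext i
      fin_cases i
      exacts [h.1, h.2]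
    set d := Int.gcd (v 0) (v 1) with hd'
    refine ⟨(⟨![v 0 / d, v 1 / d], ?_⟩, d - 1), ?_⟩
    · rw [Int.isCoprime_iff_gcd_eq_one]
      simpa using Int.gcd_ediv_gcd_ediv_gcd hd
    · refine Subtype.ext ?_
      simp only [Nat.sub_add_cancel hd]
      ext i
      fin_cases i
      · simpa using Int.mul_ediv_cancel' (Int.gcd_dvd_left (v 0) (v 1))
      · simpa using Int.mul_ediv_cancel' (Int.gcd_dvd_right (v 0) (v 1))

/-- Integer coordinates of the points of `g·ℤ²` in the disc of radius `r`. -/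
def latDisc (g : SLR 2) (r : ℝ) : Set (Fin 2 → ℤ) := {v | latPt g v ∈ disc r}

lemma isBounded_preimage_disc (g : SLR 2) (r : ℝ) : ∃ M : ℝ, ∀ p : Plane,
    g.1 *ᵥ p ∈ disc r → ∀ i, |p i| ≤ M := by
  have hdet : g.1 0 0 * g.1 1 1 - g.1 0 1 * g.1 1 0 = 1 := by
    rw [← Matrix.det_fin_two]; exact g.2
  refine ⟨(|g.1 0 0| + |g.1 0 1| + |g.1 1 0| + |g.1 1 1|) * |r|, fun p hp i => ?_⟩
  simp only [disc, Set.mem_ofPred_eq] at hp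
  set X := (g.1 *ᵥ p) 0 with hX
  set Y := (g.1 *ᵥ p) 1 with hY
  have hXr : |X| ≤ |r| := sq_le_sq.1 (by nlinarith [sq_nonneg Y])
  have hYr : |Y| ≤ |r| := sq_le_sq.1 (by nlinarith [sq_nonneg X])
  simp only [Matrix.mulVec, dotProduct, Fin.sum_univ_two] at hX hY
  have h0 : p 0 = g.1 1 1 * X - g.1 0 1 * Y := by
    rw [hX, hY]; linear_combination (-p 0) * hdet
  have h1 : p 1 = g.1 0 0 * Y - g.1 1 0 * X := by
    rw [hX, hY]; linear_combination (-p 1) * hdet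
  have key : ∀ a b : ℝ, |a * X - b * Y| ≤ (|a| + |b|) * |r| := fun a b => by
    calc |a * X - b * Y| ≤ |a * X| + |b * Y| := abs_sub _ _
      _ = |a| * |X| + |b| * |Y| := by rw [abs_mul, abs_mul]
      _ ≤ |a| * |r| + |b| * |r| := by gcongr
      _ = _ := by ring
  have hr := abs_nonneg r
  fin_cases i
  · have := key (g.1 1 1) (g.1 0 1)
    rw [← h0] at this
    refine this.trans (mul_le_mul_of_nonneg_right ?_ hr)
    linarith [abs_nonneg (g.1 0 0), abs_nonneg (g.1 1 0)]
  · have := key (g.1 1 0) (g.1 0 0)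
    rw [abs_sub_comm, ← h1] at this
    refine this.trans (mul_le_mul_of_nonneg_right ?_ hr)
    linarith [abs_nonneg (g.1 0 1), abs_nonneg (g.1 1 1)]

lemma finite_latDisc (g : SLR 2) (r : ℝ) : (latDisc g r).Finite := by
  obtain ⟨M, hM⟩ := isBounded_preimage_disc g r
  refine (Set.finite_Icc (fun _ : Fin 2 => -⌈M⌉) (fun _ => ⌈M⌉)).subset fun v hv => ?_
  have h := hM _ hv
  constructor <;> intro i
  · have h1 := (abs_le.1 (h i)).1
    have : (-⌈M⌉ : ℝ) ≤ v i := by linarith [Int.le_ceil M]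
    exact_mod_cast this
  · have h1 := (abs_le.1 (h i)).2
    have : (v i : ℝ) ≤ ⌈M⌉ := by linarith [Int.le_ceil M]
    exact_mod_cast this

lemma ncard_latDisc_eq (g : SLR 2) {r : ℝ} (hr : 0 < r) :
    ((latDisc g r).ncard : ℝ≥0∞) = 1 + ∑' k : ℕ, primMeasure g (disc (r / (k + 1))) := by
  have h1 : ((latDisc g r).ncard : ℝ≥0∞) =
      ∑' v, (latDisc g r).indicator (1 : (Fin 2 → ℤ) → ℝ≥0∞) v := by
    rw [tsum_eq_sum (s := (finite_latDisc g r).toFinset), Finset.sum_congr rfl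
      (g := fun _ => (1 : ℝ≥0∞)), Finset.sum_const, nsmul_one,
      Set.ncard_eq_toFinset_card _ (finite_latDisc g r)]
    · intro v hv
      exact Set.indicator_of_mem ((finite_latDisc g r).mem_toFinset.1 hv) _
    · intro v hv
      exact Set.indicator_of_notMem (fun h => hv ((finite_latDisc g r).mem_toFinset.2 h)) _
  have h0 : (0 : Fin 2 → ℤ) ∈ latDisc g r := by
    simp [latDisc, disc, latPt_zero_apply, latPt_one_apply, pow_pos hr 2]
  have h2 : ∑' v, (latDisc g r).indicator (1 : (Fin 2 → ℤ) → ℝ≥0∞) v =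
      1 + ∑' v : {v : Fin 2 → ℤ // v ≠ 0},
        (latDisc g r).indicator (1 : (Fin 2 → ℤ) → ℝ≥0∞) v.1 := by
    rw [← ENNReal.summable.tsum_add_tsum_compl (s := {(0 : Fin 2 → ℤ)}) ENNReal.summable,
      tsum_singleton (0 : Fin 2 → ℤ) ((latDisc g r).indicator 1), Set.indicator_of_mem h0]
    rfl
  rw [h1, h2, ← (Equiv.ofBijective _ bijective_primVec_multiple).tsum_eq]
  change 1 + ∑' q : PrimVec × ℕ, (latDisc g r).indicator (1 : (Fin 2 → ℤ) → ℝ≥0∞)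
    ((q.2 + 1) • q.1.1) = _
  rw [ENNReal.tsum_prod (f := fun (v : PrimVec) (k : ℕ) =>
    (latDisc g r).indicator (1 : (Fin 2 → ℤ) → ℝ≥0∞) ((k + 1) • v.1)), ENNReal.tsum_comm]
  congr 1
  refine tsum_congr fun k => ?_
  rw [primMeasure_apply _ (measurableSet_disc _)]
  refine tsum_congr fun v => ?_
  have hiff : (k + 1) • v.1 ∈ latDisc g r ↔ latPt g v.1 ∈ disc (r / (k + 1)) := by
    rw [← smul_mem_disc_iff (by positivity), latDisc, Set.mem_ofPred_eq, latPt_nsmul]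
    push_cast
    rfl
  by_cases h : latPt g v.1 ∈ disc (r / (k + 1))
  · rw [Set.indicator_of_mem h]
    exact Set.indicator_of_mem (hiff.2 h) _
  · rw [Set.indicator_of_notMem h]
    exact Set.indicator_of_notMem (mt hiff.1 h) _

lemma ncard_latDisc_le (g : SLR 2) (n : ℕ) :
    (latDisc g n).ncard ≤ (latDisc g 1).ncard * (16 * n ^ 2) := by
  classical
  let φ : (Fin 2 → ℤ) → ℤ × ℤ := fun v => (⌊2 * latPt g v 0⌋, ⌊2 * latPt g v 1⌋)
  rw [Set.ncard_eq_toFinset_card _ (finite_latDisc g n),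
    Set.ncard_eq_toFinset_card _ (finite_latDisc g 1)]
  have hcard : (Finset.Ico (-(2 * n) : ℤ) (2 * n) ×ˢ Finset.Ico (-(2 * n) : ℤ) (2 * n)).card
      = 16 * n ^ 2 := by
    rw [Finset.card_product, Int.card_Ico]
    have : (2 * (n : ℤ) - -(2 * n)).toNat = 4 * n := by omega
    rw [this]; ring
  rw [← hcard]
  refine Finset.card_le_mul_card_image_of_maps_to (f := φ) ?_ _ ?_
  · intro v hv
    have hv' : latPt g v 0 ^ 2 + latPt g v 1 ^ 2 < (n : ℝ) ^ 2 :=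
      (finite_latDisc g n).mem_toFinset.1 hv
    have hn : (0 : ℝ) ≤ n := n.cast_nonneg
    have h0 := abs_lt.1 (abs_lt_of_sq_lt_sq (a := latPt g v 0) (b := n)
      (by nlinarith [sq_nonneg (latPt g v 1)]) hn)
    have h1 := abs_lt.1 (abs_lt_of_sq_lt_sq (a := latPt g v 1) (b := n)
      (by nlinarith [sq_nonneg (latPt g v 0)]) hn)
    simp only [φ, Finset.mem_product, Finset.mem_Ico, Int.le_floor, Int.floor_lt]
    push_cast
    refine ⟨⟨?_, ?_⟩, ?_, ?_⟩ <;> linarith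
  · intro c _
    rcases Finset.eq_empty_or_nonempty
      (Finset.filter (fun v => φ v = c) (finite_latDisc g n).toFinset) with he | ⟨w, hw⟩
    · rw [he]; simp
    · refine Finset.card_le_card_of_injOn (fun v => v - w) ?_ (fun _ _ _ _ h => sub_left_injective h)
      intro v hv
      have hφ : φ v = φ w := (Finset.mem_filter.1 hv).2.trans (Finset.mem_filter.1 hw).2.symm
      have h0 := Int.abs_sub_lt_one_of_floor_eq_floor (congrArg Prod.fst hφ)
      have h1 := Int.abs_sub_lt_one_of_floor_eq_floor (congrArg Prod.snd hφ)
      rw [abs_lt] at h0 h1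
      refine (finite_latDisc g 1).mem_toFinset.2 ?_
      change latPt g (v - w) 0 ^ 2 + latPt g (v - w) 1 ^ 2 < 1 ^ 2
      simp only [latPt_sub, Pi.sub_apply]
      nlinarith

/-! ### Asymptotic lattice point count -/

lemma disc_eq_preimage_ball {r : ℝ} (hr : 0 ≤ r) :
    disc r = (WithLp.toLp 2) ⁻¹' Metric.ball (0 : EuclideanSpace ℝ (Fin 2)) r := by
  ext p
  simp only [disc, Set.mem_ofPred_eq, Set.mem_preimage, mem_ball_zero_iff,
    EuclideanSpace.norm_eq, Fin.sum_univ_two, Real.norm_eq_abs, sq_abs]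
  rw [Real.sqrt_lt (by positivity) hr]

lemma volume_disc_one : volume (disc 1) = ENNReal.ofReal Real.pi := by
  rw [disc_eq_preimage_ball zero_le_one,
    (PiLp.volume_preserving_toLp (Fin 2)).measure_preimage
      measurableSet_ball.nullMeasurableSet, EuclideanSpace.volume_ball_fin_two]
  simp

lemma convex_disc_one : Convex ℝ (disc 1) := by
  rw [disc_eq_preimage_ball zero_le_one]
  exact (convex_ball (0 : EuclideanSpace ℝ (Fin 2)) 1).linear_preimage
    (WithLp.linearEquiv 2 ℝ (Fin 2 → ℝ)).symm.toLinearMap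

lemma volume_preimage_disc_one (g : SLR 2) :
    volume ((g.1 *ᵥ ·) ⁻¹' disc 1) = ENNReal.ofReal Real.pi := by
  have hdet : g.1.det = 1 := g.2
  have h := Real.map_matrix_volume_pi_eq_smul_volume_pi (M := g.1) (by rw [hdet]; exact one_ne_zero)
  rw [hdet] at h
  rw [← volume_disc_one]
  have h2 := congrArg (fun m : Measure Plane => m (disc 1)) h
  simp only [inv_one, abs_one, ENNReal.ofReal_one, one_smul] at h2
  rw [← h2, Measure.map_apply]
  · rfl
  · exact measurable_mulVec g
  · exact measurableSet_disc 1

lemma tendsto_ncard_latDisc (g : SLR 2) :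
    Filter.Tendsto (fun n : ℕ => ((latDisc g n).ncard : ℝ) / (n : ℝ) ^ 2) Filter.atTop
      (nhds Real.pi) := by
  set s : Set Plane := (g.1 *ᵥ ·) ⁻¹' disc 1 with hs
  obtain ⟨M, hM⟩ := isBounded_preimage_disc g 1
  have hb : Bornology.IsBounded s := by
    refine (Metric.isBounded_Icc (fun _ : Fin 2 => -M) (fun _ => M)).subset fun p hp => ?_
    exact ⟨fun i => (abs_le.1 (hM p hp i)).1, fun i => (abs_le.1 (hM p hp i)).2⟩
  have hconv : Convex ℝ s := convex_disc_one.linear_preimage (Matrix.mulVecLin g.1)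
  have h := tendsto_card_div_pow_atTop_volume s hb (measurable_mulVec g (measurableSet_disc 1))
    (hconv.addHaar_frontier volume)
  rw [Measure.real, volume_preimage_disc_one, ENNReal.toReal_ofReal Real.pi_pos.le,
    Fintype.card_fin] at h
  refine h.congr' ?_
  filter_upwards [Filter.eventually_gt_atTop 0] with n hn
  have hn' : (n : ℝ) ≠ 0 := by positivity
  congr 2
  let f : (Fin 2 → ℤ) → Plane := fun v => (n : ℝ)⁻¹ • fun i => (v i : ℝ)
  have hf : Function.Injective f := fun v w hvw => by
    have := smul_right_injective _ (inv_ne_zero hn') hvw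
    ext i
    exact_mod_cast congrFun this i
  rw [← Set.ncard_image_of_injective _ hf]
  change Set.ncard _ = _
  congr 1
  have hmem : ∀ v, f v ∈ s ↔ v ∈ latDisc g n := fun v => by
    change g.1 *ᵥ ((n : ℝ)⁻¹ • fun i => (v i : ℝ)) ∈ disc 1 ↔ _
    rw [Matrix.mulVec_smul, smul_mem_disc_iff (by positivity), one_div, inv_inv]
    rfl
  ext p
  constructor
  · rintro ⟨hp, q, hq, rfl⟩
    have hq' := (Module.Basis.mem_span_iff_repr_mem ℤ (Pi.basisFun ℝ (Fin 2)) q).1 hq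
    choose v hv using hq'
    have hqv : q = fun i => (v i : ℝ) := by
      ext i
      simpa using (hv i).symm
    subst hqv
    exact ⟨v, (hmem v).1 hp, rfl⟩
  · rintro ⟨v, hv, rfl⟩
    refine ⟨(hmem v).2 hv, _, ?_, rfl⟩
    refine (Module.Basis.mem_span_iff_repr_mem ℤ (Pi.basisFun ℝ (Fin 2)) _).2 fun i => ?_
    exact ⟨v i, by simp⟩

/-- The number of points of a lattice in the disc of radius `r`. -/
def latCount (r : ℝ) (L : LatticeSpace 2) : ℝ≥0∞ :=
  1 + ∑' k : ℕ, latMeasure L (disc (r / (k + 1)))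

lemma latCount_mk {r : ℝ} (hr : 0 < r) (g : SLR 2) :
    latCount r (QuotientGroup.mk g) = (latDisc g r).ncard :=
  (ncard_latDisc_eq g hr).symm

lemma measurable_latCount (r : ℝ) : Measurable (latCount r) :=
  (Measurable.tsum fun _ => measurable_latMeasure_apply (measurableSet_disc _)).const_add 1

lemma tendsto_latCount (L : LatticeSpace 2) :
    Filter.Tendsto (fun n : ℕ => latCount (n + 1) L / ENNReal.ofReal ((n + 1) ^ 2)) Filter.atTop
      (nhds (ENNReal.ofReal Real.pi)) := by
  induction L using QuotientGroup.induction_on with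
  | H g =>
    have h := ENNReal.tendsto_ofReal
      ((tendsto_ncard_latDisc g).comp (Filter.tendsto_add_atTop_nat 1))
    refine h.congr fun n => ?_
    have hn : (0 : ℝ) < n + 1 := by positivity
    simp only [Function.comp]
    rw [ENNReal.ofReal_div_of_pos (by positivity), ENNReal.ofReal_natCast, latCount_mk hn]
    push_cast
    rfl

lemma latCount_div_le (n : ℕ) (L : LatticeSpace 2) :
    latCount (n + 1) L / ENNReal.ofReal ((n + 1) ^ 2) ≤ 16 * latCount 1 L := by
  induction L using QuotientGroup.induction_on with
  | H g =>
    have hn : (0 : ℝ) < n + 1 := by positivity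
    rw [latCount_mk hn, latCount_mk one_pos]
    refine ENNReal.div_le_of_le_mul ?_
    have h := ncard_latDisc_le g (n + 1)
    have h2 : ENNReal.ofReal ((n + 1 : ℝ) ^ 2) = (((n + 1) ^ 2 : ℕ) : ℝ≥0∞) := by
      rw [← ENNReal.ofReal_natCast]
      push_cast
      rfl
    rw [h2]
    push_cast at h
    calc (((latDisc g (n + 1)).ncard : ℕ) : ℝ≥0∞)
        ≤ (((latDisc g 1).ncard * (16 * (n + 1) ^ 2) : ℕ) : ℝ≥0∞) := by exact_mod_cast h
      _ = _ := by push_cast; ring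

/-! ### The mean value of the primitive counting function -/

lemma siegelMeasure_disc_half_le (μ : Measure (LatticeSpace 2)) [IsProbabilityMeasure μ] :
    siegelMeasure μ (disc (1 / 2)) ≤ 2 := by
  rw [siegelMeasure_disc μ (by norm_num)]
  calc 2 * μ _ ≤ 2 * 1 := by gcongr; exact prob_le_one
    _ = 2 := mul_one 2

lemma disc_eq_preimage_smul {r : ℝ} (hr : 0 < r) :
    disc r = (fun p : Plane => r⁻¹ • p) ⁻¹' disc 1 := by
  ext p
  rw [Set.mem_preimage, smul_mem_disc_iff (inv_pos.2 hr), one_div, inv_inv]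

lemma siegelMeasure_disc_eq (μ : Measure (LatticeSpace 2)) [IsProbabilityMeasure μ]
    (hinv : ∀ (g : SLR 2) (s : Set (LatticeSpace 2)), μ ((g • ·) ⁻¹' s) = μ s)
    {r : ℝ} (hr : 0 < r) :
    siegelMeasure μ (disc r) = ENNReal.ofReal (r ^ 2) * siegelMeasure μ (disc 1) := by
  have hν : SLInvariant (siegelMeasure μ) := measurePreserving_siegelMeasure μ hinv
  have := sigmaFinite_of_invariant hν
    ((siegelMeasure_disc_half_le μ).trans_lt ENNReal.ofNat_lt_top)
  rw [disc_eq_preimage_smul hr]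
  exact measure_dilation hν (siegelMeasure_zero μ) (measurableSet_disc 1) hr

lemma siegelMeasure_disc_one_ne_top (μ : Measure (LatticeSpace 2)) [IsProbabilityMeasure μ]
    (hinv : ∀ (g : SLR 2) (s : Set (LatticeSpace 2)), μ ((g • ·) ⁻¹' s) = μ s) :
    siegelMeasure μ (disc 1) ≠ ∞ := by
  intro h
  have h1 := siegelMeasure_disc_half_le μ
  rw [siegelMeasure_disc_eq μ hinv (by norm_num), h, ENNReal.mul_top] at h1
  · exact absurd h1 (by simp)
  · simp

lemma tsum_ofReal_inv_succ_sq :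
    ∑' k : ℕ, ENNReal.ofReal ((1 / ((k : ℝ) + 1)) ^ 2) = ENNReal.ofReal (Real.pi ^ 2 / 6) := by
  have h : HasSum (fun k : ℕ => (1 / ((k : ℝ) + 1)) ^ 2) (Real.pi ^ 2 / 6) := by
    have := (hasSum_nat_add_iff' 1).2 hasSum_zeta_two
    simpa [div_pow] using this
  rw [← h.tsum_eq, ENNReal.ofReal_tsum_of_nonneg (fun _ => by positivity) h.summable]

lemma lintegral_latCount (μ : Measure (LatticeSpace 2)) [IsProbabilityMeasure μ]
    (hinv : ∀ (g : SLR 2) (s : Set (LatticeSpace 2)), μ ((g • ·) ⁻¹' s) = μ s)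
    {r : ℝ} (hr : 0 < r) :
    ∫⁻ L, latCount r L ∂μ = 1 + ENNReal.ofReal (r ^ 2) *
      (ENNReal.ofReal (Real.pi ^ 2 / 6) * siegelMeasure μ (disc 1)) := by
  unfold latCount
  rw [lintegral_add_left measurable_const, lintegral_const, measure_univ, mul_one,
    lintegral_tsum fun _ => (measurable_latMeasure_apply (measurableSet_disc _)).aemeasurable]
  congr 1
  rw [← tsum_ofReal_inv_succ_sq, ← ENNReal.tsum_mul_right, ← ENNReal.tsum_mul_left]
  refine tsum_congr fun k => ?_
  rw [← siegelMeasure_apply _ (measurableSet_disc _), siegelMeasure_disc_eq μ hinv (by positivity),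
    ← mul_assoc, ← ENNReal.ofReal_mul (by positivity)]
  congr 2
  field_simp

lemma zeta_two_mul_siegelMeasure_disc_one (μ : Measure (LatticeSpace 2)) [IsProbabilityMeasure μ]
    (hinv : ∀ (g : SLR 2) (s : Set (LatticeSpace 2)), μ ((g • ·) ⁻¹' s) = μ s) :
    ENNReal.ofReal (Real.pi ^ 2 / 6) * siegelMeasure μ (disc 1) = ENNReal.ofReal Real.pi := by
  set c := ENNReal.ofReal (Real.pi ^ 2 / 6) * siegelMeasure μ (disc 1) with hc
  have hctop : c ≠ ∞ := ENNReal.mul_ne_top ENNReal.ofReal_ne_top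
    (siegelMeasure_disc_one_ne_top μ hinv)
  have hlim := tendsto_lintegral_of_dominated_convergence (μ := μ)
    (F := fun (n : ℕ) L => latCount (n + 1) L / ENNReal.ofReal ((n + 1) ^ 2))
    (f := fun _ => ENNReal.ofReal Real.pi) (fun L => 16 * latCount 1 L)
    (fun n => (measurable_latCount _).div_const _)
    (fun n => Filter.Eventually.of_forall (latCount_div_le n))
    (by
      rw [lintegral_const_mul _ (measurable_latCount 1), lintegral_latCount μ hinv one_pos]
      exact ENNReal.mul_ne_top ENNReal.ofNat_ne_top (ENNReal.add_ne_top.2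
        ⟨ENNReal.one_ne_top, ENNReal.mul_ne_top ENNReal.ofReal_ne_top hctop⟩))
    (Filter.Eventually.of_forall tendsto_latCount)
  rw [lintegral_const, measure_univ, mul_one] at hlim
  have hint : ∀ n : ℕ, ∫⁻ L, latCount (n + 1) L / ENNReal.ofReal ((n + 1) ^ 2) ∂μ
      = (ENNReal.ofReal ((n + 1) ^ 2))⁻¹ + c := fun n => by
    have hn : (0 : ℝ) < n + 1 := by positivity
    have h0 : ENNReal.ofReal ((n + 1 : ℝ) ^ 2) ≠ 0 :=
      (ENNReal.ofReal_pos.2 (pow_pos hn 2)).ne'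
    simp only [div_eq_mul_inv]
    rw [lintegral_mul_const _ (measurable_latCount _), lintegral_latCount μ hinv hn, add_mul,
      one_mul, mul_right_comm, ENNReal.mul_inv_cancel h0 ENNReal.ofReal_ne_top, one_mul]
  simp only [hint] at hlim
  have hlim2 : Filter.Tendsto (fun n : ℕ => (ENNReal.ofReal ((n + 1 : ℝ) ^ 2))⁻¹ + c) Filter.atTop
      (nhds (0 + c)) := by
    refine Filter.Tendsto.add_const c ?_
    rw [← ENNReal.inv_top]
    refine (ENNReal.tendsto_ofReal_atTop.comp ?_).inv
    exact (Filter.tendsto_pow_atTop two_ne_zero).comp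
      (Filter.tendsto_atTop_add_const_right _ 1 tendsto_natCast_atTop_atTop)
  rw [zero_add] at hlim2
  exact tendsto_nhds_unique hlim2 hlim

lemma measure_latMeasure_disc_ne_zero (μ : Measure (LatticeSpace 2)) [IsProbabilityMeasure μ]
    (hinv : ∀ (g : SLR 2) (s : Set (LatticeSpace 2)), μ ((g • ·) ⁻¹' s) = μ s)
    {r : ℝ} (hr : 0 < r) (hr1 : r ^ 2 ≤ 1) :
    μ {L | latMeasure L (disc r) ≠ 0} = ENNReal.ofReal (3 / Real.pi * r ^ 2) := by
  have hpi := Real.pi_pos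
  have h1 := siegelMeasure_disc μ hr1
  rw [siegelMeasure_disc_eq μ hinv hr] at h1
  have h2 := congrArg ENNReal.toReal (zeta_two_mul_siegelMeasure_disc_one μ hinv)
  rw [ENNReal.toReal_mul, ENNReal.toReal_ofReal (by positivity),
    ENNReal.toReal_ofReal hpi.le] at h2
  have h3 := congrArg ENNReal.toReal h1
  rw [ENNReal.toReal_mul, ENNReal.toReal_ofReal (by positivity), ENNReal.toReal_mul,
    ENNReal.toReal_ofNat] at h3
  rw [← ENNReal.ofReal_toReal (measure_ne_top μ _)]
  congr 1
  have h4 : (siegelMeasure μ (disc 1)).toReal = 6 / Real.pi := by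
    field_simp at h2 ⊢
    linarith
  rw [h4] at h3
  field_simp at h3 ⊢
  linarith

/-! ### The minimal norm -/

lemma norm_latVec_sq (g : SLR 2) (v : Fin 2 → ℤ) :
    ‖latVec g v‖ ^ 2 = latPt g v 0 ^ 2 + latPt g v 1 ^ 2 := by
  rw [EuclideanSpace.norm_sq_eq, Fin.sum_univ_two]
  simp only [Real.norm_eq_abs, sq_abs]
  rfl

lemma latVec_zero {d : ℕ} (g : SLR d) : latVec g 0 = 0 := by
  have h : (fun i => (((0 : Fin d → ℤ) i : ℤ) : ℝ)) = 0 := funext fun _ => Int.cast_zero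
  unfold latVec
  rw [h, Matrix.mulVec_zero]
  rfl

lemma latVec_ne_zero {g : SLR 2} {v : Fin 2 → ℤ} (hv : v ≠ 0) : latVec g v ≠ 0 := by
  intro h
  have h2 := norm_latVec_sq g v
  rw [h, norm_zero, zero_pow two_ne_zero] at h2
  have h0 : latPt g v 0 = 0 := by nlinarith [sq_nonneg (latPt g v 1), sq_nonneg (latPt g v 0)]
  have h1 : latPt g v 1 = 0 := by nlinarith [sq_nonneg (latPt g v 1), sq_nonneg (latPt g v 0)]
  have hc := latPt_cross g v ![-v 1, v 0]
  simp only [h0, h1, zero_mul, sub_zero, Matrix.cons_val_zero, Matrix.cons_val_one] at hc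
  have hc' : v 0 * v 0 - v 1 * -v 1 = 0 := by exact_mod_cast hc.symm
  apply hv
  ext i
  fin_cases i
  · change v 0 = 0
    nlinarith [sq_nonneg (v 0), sq_nonneg (v 1)]
  · change v 1 = 0
    nlinarith [sq_nonneg (v 0), sq_nonneg (v 1)]

lemma gMin_set_nonempty (g : SLR 2) :
    {r : ℝ | ∃ v : Fin 2 → ℤ, latVec g v ≠ 0 ∧ ‖latVec g v‖ = r}.Nonempty :=
  ⟨_, ![1, 0], latVec_ne_zero fun h => by simpa using congrFun h 0, rfl⟩

lemma gMin_pos (g : SLR 2) : 0 < gMin g := by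
  obtain ⟨m, hm, hmin⟩ : ∃ m > 0, ∀ v : Fin 2 → ℤ, v ≠ 0 → m ≤ ‖latVec g v‖ := by
    let A := (finite_latDisc g 1).toFinset.filter (· ≠ 0)
    rcases A.eq_empty_or_nonempty with hA | hA
    · refine ⟨1, one_pos, fun v hv => ?_⟩
      by_contra! hlt
      have : v ∈ A := by
        refine Finset.mem_filter.2 ⟨(finite_latDisc g 1).mem_toFinset.2 ?_, hv⟩
        change latPt g v 0 ^ 2 + latPt g v 1 ^ 2 < 1 ^ 2
        rw [← norm_latVec_sq]
        gcongr
      rw [hA] at this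
      exact absurd this (Finset.notMem_empty v)
    · obtain ⟨w, hw, hwmin⟩ := A.exists_min_image (fun v => ‖latVec g v‖) hA
      refine ⟨‖latVec g w‖, norm_pos_iff.2 (latVec_ne_zero (Finset.mem_filter.1 hw).2),
        fun v hv => ?_⟩
      by_cases hvA : v ∈ A
      · exact hwmin v hvA
      · have hw1 : ‖latVec g w‖ ^ 2 < 1 ^ 2 := by
          rw [norm_latVec_sq]
          exact (finite_latDisc g 1).mem_toFinset.1 (Finset.mem_filter.1 hw).1
        have hv1 : ¬ ‖latVec g v‖ ^ 2 < 1 ^ 2 := fun h => hvA <| by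
          refine Finset.mem_filter.2 ⟨(finite_latDisc g 1).mem_toFinset.2 ?_, hv⟩
          rw [norm_latVec_sq] at h
          exact h
        exact (sq_le_sq₀ (norm_nonneg _) (norm_nonneg _)).1 (hw1.le.trans (not_lt.1 hv1))
  refine hm.trans_le (le_csInf (gMin_set_nonempty g) ?_)
  rintro _ ⟨v, hv, rfl⟩
  exact hmin v fun h => hv (h ▸ latVec_zero g)

lemma gMin_lt_iff (g : SLR 2) {r : ℝ} (hr : 0 < r) :
    gMin g < r ↔ ∃ v : PrimVec, latPt g v.1 ∈ disc r := by
  have hmem : ∀ v, latPt g v ∈ disc r ↔ ‖latVec g v‖ < r := fun v => by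
    rw [← pow_lt_pow_iff_left₀ (norm_nonneg _) hr.le two_ne_zero, norm_latVec_sq]
    rfl
  constructor
  · intro h
    obtain ⟨_, ⟨v, hv, rfl⟩, hlt⟩ := exists_lt_of_csInf_lt (gMin_set_nonempty g) h
    have hv0 : v ≠ 0 := by
      rintro rfl
      exact hv (latVec_zero g)
    obtain ⟨⟨w, k⟩, hwk⟩ := bijective_primVec_multiple.2 ⟨v, hv0⟩
    have hwk' : (k + 1) • w.1 = v := congrArg Subtype.val hwk
    have h1 := (hmem v).2 hlt
    rw [← hwk', latPt_nsmul] at h1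
    refine ⟨w, ?_⟩
    simp only [disc, Set.mem_ofPred_eq, Pi.smul_apply, smul_eq_mul, mul_pow] at h1 ⊢
    push_cast at h1
    nlinarith [sq_nonneg (latPt g w.1 0), sq_nonneg (latPt g w.1 1), sq_nonneg (k : ℝ),
      (k.cast_nonneg : (0 : ℝ) ≤ k), mul_nonneg (k.cast_nonneg : (0 : ℝ) ≤ k)
      (add_nonneg (sq_nonneg (latPt g w.1 0)) (sq_nonneg (latPt g w.1 1))),
      mul_nonneg (sq_nonneg (k : ℝ))
      (add_nonneg (sq_nonneg (latPt g w.1 0)) (sq_nonneg (latPt g w.1 1)))]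
  · rintro ⟨v, hv⟩
    refine lt_of_le_of_lt (b := ‖latVec g v.1‖)
      (csInf_le ⟨0, ?_⟩ ⟨v.1, latVec_ne_zero (primVec_ne_zero v), rfl⟩) ((hmem v.1).1 hv)
    rintro _ ⟨w, _, rfl⟩
    exact norm_nonneg _

lemma lt_inv_gMin_sq_iff (g : SLR 2) {a : ℝ} (ha : 0 < a) :
    a < (gMin g ^ 2)⁻¹ ↔ primMeasure g (disc (√a)⁻¹) ≠ 0 := by
  have hr : 0 < (√a)⁻¹ := inv_pos.2 (Real.sqrt_pos.2 ha)
  rw [primMeasure_disc_ne_zero_iff, ← gMin_lt_iff g hr, lt_inv_comm₀ ha (pow_pos (gMin_pos g) 2),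
    ← pow_lt_pow_iff_left₀ (gMin_pos g).le hr.le two_ne_zero, inv_pow, Real.sq_sqrt ha.le]

/-- For the normalized Haar probability measure `μ₂` on `𝒮₂ = SL₂(ℝ)/SL₂(ℤ)` (formalized
as: any `SL₂(ℝ)`-invariant Borel probability measure), there is `a₀` such that for all
`a ≥ a₀`, `μ₂({L : ‖L‖⁻² > a}) = (3/π)·a⁻¹`. -/
theorem stmt6 (μ : Measure (LatticeSpace 2)) [IsProbabilityMeasure μ]
    (hinv : ∀ (g : SLR 2) (s : Set (LatticeSpace 2)), μ ((g • ·) ⁻¹' s) = μ s) :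
    ∃ a₀ : ℝ, ∀ a : ℝ, a₀ ≤ a →
      μ (QuotientGroup.mk '' {g : SLR 2 | a < (gMin g ^ 2)⁻¹})
        = ENNReal.ofReal (3 / Real.pi * a⁻¹) := by
  refine ⟨1, fun a ha => ?_⟩
  have ha0 : 0 < a := one_pos.trans_le ha
  have hsq : (√a)⁻¹ ^ 2 = a⁻¹ := by rw [inv_pow, Real.sq_sqrt ha0.le]
  have hset : (QuotientGroup.mk '' {g : SLR 2 | a < (gMin g ^ 2)⁻¹} : Set (LatticeSpace 2)) =
      {L | latMeasure L (disc (√a)⁻¹) ≠ 0} := by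
    ext L
    constructor
    · rintro ⟨g, hg, rfl⟩
      exact (lt_inv_gMin_sq_iff g ha0).1 hg
    · induction L using QuotientGroup.induction_on with
      | H g => exact fun h => ⟨g, (lt_inv_gMin_sq_iff g ha0).2 h, rfl⟩
  rw [hset, measure_latMeasure_disc_ne_zero μ hinv (inv_pos.2 (Real.sqrt_pos.2 ha0))
    (hsq.trans_le (inv_le_one_of_one_le₀ ha)), hsq]
end
end
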